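/- Let u be a classical solution of the inequality ∂u/∂t − Σ_{i,j=1}^n a_{ij}(x,u) ∂²u/∂x_i∂x_j + f(x,u,Du) ≤ 0 in ℝ₊^{n+1}, under the structural assumptions on a_{ij}, f, g, h, p, and let θ > 1. There exists a constant C > 0, depending only on n and θ, with the following property: whenever r > 0 and t > 0 satisfy 4r² < t and θ^{1/2} · sup_{Q_r^{t−r²,t}} u ≥ sup_{Q_{2r}^{t−4r²,t}} u > 0, then, with M₁ := sup_{Q_r^{t−r²,t}} u and M₂ := sup_{Q_{2r}^{t−4r²,t}} u, at least one of the following two estimates holds: (i) ∫_{M₁}^{M₂} dζ / g_{√θ}(ζ) ≥ C ∫_r^{2r} ρ q(2ρ) dρ; (ii) ∫_{M₁}^{M₂} dζ / h_{√θ}(ζ) ≥ C ∫_r^{2r} ρ q(2ρ) dρ. -/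

import Mathlib

open Set Filter MeasureTheory Metric

noncomputable section

/-- `n`-dimensional Euclidean space. -/
abbrev Eucl (n : ℕ) := EuclideanSpace ℝ (Fin n)

open Asymptotics in
/-- A function on `ℝⁿ` with continuous partial derivatives is Fréchet differentiable. -/
theorem hasFDerivAt_of_continuous_partials {n : ℕ} {F : Eucl n → ℝ} {D : Fin n → Eucl n → ℝ}
    (hF : ∀ x i, HasDerivAt (fun s : ℝ => F (x + s • EuclideanSpace.single i (1 : ℝ))) (D i x) 0)
    (hD : ∀ i, Continuous (D i)) (x : Eucl n) :
    HasFDerivAt F (∑ i, D i x • (EuclideanSpace.proj i : Eucl n →L[ℝ] ℝ)) x := by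
  set e : Fin n → Eucl n := fun i => EuclideanSpace.single i (1 : ℝ) with he
  have hline : ∀ z i (s : ℝ), HasDerivAt (fun s : ℝ => F (z + s • e i)) (D i (z + s • e i)) s := by
    intro z i s
    have h1 := hF (z + s • e i) i
    have h2 : HasDerivAt (fun τ : ℝ => τ - s) 1 s := (hasDerivAt_id s).sub_const s
    have h3 := HasDerivAt.scomp_of_eq s h1 h2 (by simp)
    refine (h3.congr_deriv (by simp)).congr_of_eventuallyEq (Eventually.of_forall fun τ => ?_)
    simp only [Function.comp_apply]
    congr 1
    rw [add_assoc, ← add_smul]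
    congr 2
    ring
  have hkey : ∀ S : Finset (Fin n),
      (fun y : Eucl n => F (x + ∑ i ∈ S, y i • e i) - F x - ∑ i ∈ S, D i x * y i)
        =o[nhds 0] (fun y => y) := by
    intro S
    induction S using Finset.induction_on with
    | empty => simp
    | insert j S hj ih =>
      have hstep : (fun y : Eucl n => F (x + ∑ i ∈ S, y i • e i + y j • e j)
          - F (x + ∑ i ∈ S, y i • e i) - D j x * y j) =o[nhds 0] (fun y => y) := by
        rw [isLittleO_iff]
        intro ε hε
        obtain ⟨δ, hδ, hball⟩ := Metric.continuousAt_iff.1 ((hD j).continuousAt (x := x)) ε hε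
        have hev : ∀ᶠ y : Eucl n in nhds 0, (S.card + 1 : ℝ) * ‖y‖ < δ := by
          have : Tendsto (fun y : Eucl n => (S.card + 1 : ℝ) * ‖y‖) (nhds 0) (nhds 0) := by
            have : Continuous (fun y : Eucl n => (S.card + 1 : ℝ) * ‖y‖) := by fun_prop
            simpa using this.tendsto 0
          exact this.eventually (gt_mem_nhds hδ)
        filter_upwards [hev] with y hy
        set z := x + ∑ i ∈ S, y i • e i with hz
        have hcoord : ∀ i, |y i| ≤ ‖y‖ := fun i => by
          simpa using EuclideanSpace.norm_eq y ▸ PiLp.norm_apply_le y i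
        have hclose : ∀ s ∈ uIcc 0 (y j), ‖D j (z + s • e j) - D j x‖ ≤ ε := by
          intro s hs
          have hs' : |s| ≤ ‖y‖ := by
            have := abs_sub_left_of_mem_uIcc hs
            simp only [sub_zero] at this
            exact this.trans (hcoord j)
          have := hball (x := z + s • e j) (by
            rw [dist_eq_norm]
            refine lt_of_le_of_lt ?_ hy
            have : z + s • e j - x = ∑ i ∈ S, y i • e i + s • e j := by rw [hz]; abel
            rw [this]
            have h1 : ‖∑ i ∈ S, y i • e i‖ ≤ S.card * ‖y‖ := by
              refine (norm_sum_le _ _).trans ?_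
              rw [← nsmul_eq_mul]
              refine Finset.sum_le_card_nsmul _ _ _ fun i _ => ?_
              simpa [he, norm_smul] using hcoord i
            have h2 : ‖s • e j‖ ≤ ‖y‖ := by simpa [he, norm_smul] using hs'
            calc _ ≤ _ := norm_add_le _ _
              _ ≤ _ := by linarith)
          rw [Real.dist_eq] at this
          exact this.le
        have hmv := (convex_uIcc (0 : ℝ) (y j)).norm_image_sub_le_of_norm_hasDerivWithin_le
          (f := fun s => F (z + s • e j) - D j x * s)
          (f' := fun s => D j (z + s • e j) - D j x) (C := ε)
          (fun s _ => (((hline z j s).sub ((hasDerivAt_id s).const_mul (D j x))).congr_deriv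
            (by simp)).hasDerivWithinAt) hclose left_mem_uIcc right_mem_uIcc
        simp only [zero_smul, add_zero, mul_zero, sub_zero] at hmv
        calc _ = ‖F (z + y j • e j) - D j x * y j - F z‖ := by congr 1; ring
          _ ≤ _ := hmv
          _ ≤ _ := by gcongr; exact hcoord j
      refine (hstep.add ih).congr_left fun y => ?_
      rw [Finset.sum_insert hj, Finset.sum_insert hj]
      have : x + ∑ i ∈ S, y i • e i + y j • e j = x + (y j • e j + ∑ i ∈ S, y i • e i) := by abel
      rw [this]
      ring
  rw [hasFDerivAt_iff_isLittleO_nhds_zero]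
  refine (hkey Finset.univ).congr_left fun y => ?_
  have : ∑ i, y i • e i = y := by
    ext k
    simp [he, Pi.single_apply]
  rw [this]
  simp

/-- Second-derivative test: at a local maximum the second derivative is nonpositive. -/
theorem IsLocalMax.second_deriv_nonpos {f f' : ℝ → ℝ} {c : ℝ} (hmax : IsLocalMax f 0)
    (hf : ∀ s, HasDerivAt f (f' s) s) (hf' : HasDerivAt f' c 0) : c ≤ 0 := by
  by_contra! hc
  have hd : deriv f = f' := funext fun s => (hf s).deriv
  have hmin : IsLocalMin f 0 := isLocalMin_of_deriv_deriv_pos (by rw [hd, hf'.deriv]; exact hc)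
    hmax.deriv_eq_zero (hf 0).continuousAt
  have hconst : f =ᶠ[nhds 0] fun _ => f 0 := by
    filter_upwards [hmax, hmin] with s h1 h2 using le_antisymm h1 h2
  have : deriv (deriv f) 0 = 0 := by
    rw [hconst.deriv.deriv_eq]
    simp
  rw [hd, hf'.deriv] at this
  exact hc.ne' this

open scoped MatrixOrder in
/-- If `a` is positive definite and `B` is positive semidefinite, then `∑ aᵢⱼ Bᵢⱼ ≥ 0`. -/
theorem sum_mul_nonneg_of_posSemidef {n : ℕ} {a B : Fin n → Fin n → ℝ}
    (ha : ∀ ξ : Eucl n, ξ ≠ 0 → 0 < ∑ i, ∑ j, a i j * ξ i * ξ j)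
    (hsymm : ∀ i j, B i j = B j i) (hB : ∀ ξ : Fin n → ℝ, 0 ≤ ∑ i, ∑ j, B i j * ξ i * ξ j) :
    0 ≤ ∑ i, ∑ j, a i j * B i j := by
  have hps : (Matrix.of B).PosSemidef := by
    refine Matrix.PosSemidef.of_dotProduct_mulVec_nonneg ?_ fun ξ => ?_
    · ext i j
      exact hsymm j i
    · refine (hB ξ).trans_eq ?_
      simp only [dotProduct, Matrix.mulVec, Matrix.of_apply, Finset.mul_sum, star_trivial]
      exact Finset.sum_congr rfl fun i _ => Finset.sum_congr rfl fun j _ => by ring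
  obtain ⟨R, hR⟩ := CStarAlgebra.nonneg_iff_eq_star_mul_self.1 hps.nonneg
  have hBR : ∀ i j, B i j = ∑ k, R k i * R k j := fun i j => by
    have := congrFun (congrFun hR i) j
    simpa [Matrix.mul_apply] using this
  have : ∑ i, ∑ j, a i j * B i j = ∑ k, ∑ i, ∑ j, a i j * R k i * R k j := by
    simp_rw [hBR, Finset.mul_sum, mul_assoc]
    rw [Finset.sum_comm]
    refine (Finset.sum_congr rfl fun i _ => Finset.sum_comm).trans ?_
    rw [Finset.sum_comm]
    exact Finset.sum_congr rfl fun k _ => Finset.sum_comm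
  rw [this]
  refine Finset.sum_nonneg fun k _ => ?_
  by_cases hk : WithLp.toLp 2 (R k) = (0 : Eucl n)
  · have h0 : ∀ i, R k i = 0 := fun i => by simpa using congrArg (fun v : Eucl n => v i) hk
    simp [h0]
  · simpa using (ha _ hk).le

/-- First and second derivatives along lines, and symmetry of the Hessian, from continuous
second-order partial derivatives. -/
theorem line_derivs_of_continuous_partials {n : ℕ} {F : Eucl n → ℝ} {D : Fin n → Eucl n → ℝ}
    {H : Fin n → Fin n → Eucl n → ℝ}
    (hF : ∀ x i, HasDerivAt (fun s : ℝ => F (x + s • EuclideanSpace.single i (1 : ℝ))) (D i x) 0)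
    (hD : ∀ x i j,
      HasDerivAt (fun s : ℝ => D i (x + s • EuclideanSpace.single j (1 : ℝ))) (H i j x) 0)
    (hDc : ∀ i, Continuous (D i)) (hHc : ∀ i j, Continuous (H i j)) (x : Eucl n) :
    (∀ ξ : Eucl n, ∀ s : ℝ, HasDerivAt (fun s : ℝ => F (x + s • ξ))
      (∑ i, D i (x + s • ξ) * ξ i) s) ∧
    (∀ ξ : Eucl n, HasDerivAt (fun s : ℝ => ∑ i, D i (x + s • ξ) * ξ i)
      (∑ i, ∑ j, H i j x * ξ i * ξ j) 0) ∧
    ∀ i j, H i j x = H j i x := by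
  have hF' := hasFDerivAt_of_continuous_partials hF hDc
  have hD' := fun i => hasFDerivAt_of_continuous_partials (fun x j => hD x i j) (hHc i)
  have hl : ∀ (ξ : Eucl n) (s : ℝ), HasDerivAt (fun s : ℝ => x + s • ξ) ξ s := fun ξ s => by
    simpa using ((hasDerivAt_id s).smul_const ξ).const_add x
  refine ⟨fun ξ s => ?_, fun ξ => ?_, fun i j => ?_⟩
  · exact ((hF' _).comp_hasDerivAt s (hl ξ s)).congr_deriv (by simp)
  · refine HasDerivAt.fun_sum fun i _ => ?_
    have := ((hD' i x).comp_hasDerivAt_of_eq 0 (hl ξ 0) (by simp)).mul_const (ξ i)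
    refine this.congr_deriv ?_
    simp only [sum_apply, Finset.sum_mul]
    exact Finset.sum_congr rfl fun j _ => by simp; ring
  · have h2 := HasFDerivAt.fun_sum (u := Finset.univ) fun k _ =>
      (hD' k x).smul_const (EuclideanSpace.proj k : Eucl n →L[ℝ] ℝ)
    have := second_derivative_symmetric hF' h2 (EuclideanSpace.single i 1)
      (EuclideanSpace.single j 1)
    simpa [sum_apply, eq_comm] using this

/-- Touching a function from above by a multiple of `‖y‖ ^ (2 * (m + 2))`: the gradient is
radial and the elliptic operator is bounded. -/
theorem derivs_of_isLocalMax_sub_norm_pow {n : ℕ} {F : Eucl n → ℝ} {D : Fin n → Eucl n → ℝ}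
    {H : Fin n → Fin n → Eucl n → ℝ}
    (hF : ∀ x i, HasDerivAt (fun s : ℝ => F (x + s • EuclideanSpace.single i (1 : ℝ))) (D i x) 0)
    (hD : ∀ x i j,
      HasDerivAt (fun s : ℝ => D i (x + s • EuclideanSpace.single j (1 : ℝ))) (H i j x) 0)
    (hDc : ∀ i, Continuous (D i)) (hHc : ∀ i j, Continuous (H i j)) {a : Fin n → Fin n → ℝ}
    (ha : ∀ ξ : Eucl n, ξ ≠ 0 → 0 < ∑ i, ∑ j, a i j * ξ i * ξ j) {c R : ℝ} (hc : 0 ≤ c)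
    (m : ℕ) {x : Eucl n} (hx : ‖x‖ ^ 2 ≤ R)
    (hmax : IsLocalMax (fun y => F y - c * (‖y‖ ^ 2) ^ (m + 2)) x) :
    (∀ i, D i x = 2 * (m + 2) * c * (‖x‖ ^ 2) ^ (m + 1) * x i) ∧
      ∑ i, ∑ j, a i j * H i j x ≤
        4 * (m + 2) ^ 2 * c * R ^ (m + 1) * ∑ i, ∑ j, |a i j| := by
  obtain ⟨h1, h2, hsymm⟩ := line_derivs_of_continuous_partials hF hD hDc hHc x
  have hP : ∀ (ξ : Eucl n) (s : ℝ), HasDerivAt (fun s : ℝ => ‖x + s • ξ‖ ^ 2)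
      (2 * inner ℝ x ξ + 2 * s * ‖ξ‖ ^ 2) s := by
    intro ξ s
    have h : HasDerivAt (fun s : ℝ => ‖x‖ ^ 2 + s * (2 * inner ℝ x ξ) + s ^ 2 * ‖ξ‖ ^ 2)
        (1 * (2 * inner ℝ x ξ) + (2 * s) * ‖ξ‖ ^ 2) s := by
      refine HasDerivAt.add (HasDerivAt.const_add _ ((hasDerivAt_id s).mul_const _)) ?_
      simpa using (hasDerivAt_pow 2 s).mul_const (‖ξ‖ ^ 2)
    refine (h.congr_deriv (by ring)).congr_of_eventuallyEq (Eventually.of_forall fun τ => ?_)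
    simp only
    rw [norm_add_sq_real, inner_smul_right, norm_smul, mul_pow, Real.norm_eq_abs, sq_abs]
    ring
  have hline : ∀ (ξ : Eucl n) (s : ℝ),
      HasDerivAt (fun s : ℝ => F (x + s • ξ) - c * (‖x + s • ξ‖ ^ 2) ^ (m + 2))
        (∑ i, D i (x + s • ξ) * ξ i - c * ((m + 2) * (‖x + s • ξ‖ ^ 2) ^ (m + 1) *
          (2 * inner ℝ x ξ + 2 * s * ‖ξ‖ ^ 2))) s := fun ξ s =>
    (h1 ξ s).sub (((hP ξ s).pow (m + 2)).const_mul c |>.congr_deriv (by push_cast; simp))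
  have hline2 : ∀ ξ : Eucl n,
      HasDerivAt (fun s : ℝ => ∑ i, D i (x + s • ξ) * ξ i -
          c * ((m + 2) * (‖x + s • ξ‖ ^ 2) ^ (m + 1) * (2 * inner ℝ x ξ + 2 * s * ‖ξ‖ ^ 2)))
        (∑ i, ∑ j, H i j x * ξ i * ξ j - (2 * (m + 2) * c * (‖x‖ ^ 2) ^ (m + 1) * ‖ξ‖ ^ 2 +
          4 * (m + 2) * (m + 1) * c * (‖x‖ ^ 2) ^ m * inner ℝ x ξ ^ 2)) 0 := by
    intro ξ
    have hlin : HasDerivAt (fun s : ℝ => 2 * inner ℝ x ξ + 2 * s * ‖ξ‖ ^ 2) (2 * ‖ξ‖ ^ 2) 0 := by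
      simpa using (((hasDerivAt_id (0 : ℝ)).const_mul 2).mul_const (‖ξ‖ ^ 2)).const_add
        (2 * inner ℝ x ξ)
    refine (h2 ξ).sub ((((((hP ξ 0).pow (m + 1)).const_mul ((m : ℝ) + 2)).mul
      hlin).const_mul c).congr_deriv ?_)
    simp
    ring
  have hmaxl : ∀ ξ : Eucl n,
      IsLocalMax (fun s : ℝ => F (x + s • ξ) - c * (‖x + s • ξ‖ ^ 2) ^ (m + 2)) 0 := by
    intro ξ
    have ht : Tendsto (fun s : ℝ => x + s • ξ) (nhds 0) (nhds x) := by
      have : Continuous (fun s : ℝ => x + s • ξ) := by fun_prop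
      simpa using this.tendsto 0
    have := ht.eventually hmax
    simpa [IsLocalMax, IsMaxFilter] using this
  have hgrad : ∀ i, D i x = 2 * (m + 2) * c * (‖x‖ ^ 2) ^ (m + 1) * x i := by
    intro i
    have := (hmaxl (EuclideanSpace.single i 1)).hasDerivAt_eq_zero (hline _ 0)
    simp [EuclideanSpace.inner_single_right] at this
    linarith
  refine ⟨hgrad, ?_⟩
  set l := 2 * (m + 2) * c * (‖x‖ ^ 2) ^ (m + 1) with hl
  set k := 4 * (m + 2) * (m + 1) * c * (‖x‖ ^ 2) ^ m with hk
  have hl0 : 0 ≤ l := by positivity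
  have hk0 : 0 ≤ k := by positivity
  have hquad : ∀ ξ : Eucl n, ∑ i, ∑ j, H i j x * ξ i * ξ j ≤ l * ‖ξ‖ ^ 2 + k * inner ℝ x ξ ^ 2 :=
    fun ξ => by linarith [(hmaxl ξ).second_deriv_nonpos (hline ξ) (hline2 ξ)]
  have htr := sum_mul_nonneg_of_posSemidef
    (B := fun i j => (if i = j then l else 0) + k * (x i * x j) - H i j x) ha
    (fun i j => by simp only [hsymm i j, mul_comm (x i), eq_comm]) (fun ξ => by
      have h3 := hquad (WithLp.toLp 2 ξ)
      have h4 : ∑ i, ∑ j, ((if i = j then l else 0) + k * (x i * x j) - H i j x) * ξ i * ξ j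
          = l * ∑ i, ξ i ^ 2 + k * (∑ i, x i * ξ i) ^ 2 - ∑ i, ∑ j, H i j x * ξ i * ξ j := by
        simp_rw [sub_mul, add_mul, Finset.sum_sub_distrib, Finset.sum_add_distrib]
        congr 2
        · simp [Finset.mul_sum, pow_two, mul_assoc]
        · rw [pow_two, Finset.sum_mul_sum, Finset.mul_sum]
          refine Finset.sum_congr rfl fun i _ => ?_
          rw [Finset.mul_sum]
          exact Finset.sum_congr rfl fun j _ => by ring
      rw [h4]
      have h5 : inner ℝ x (WithLp.toLp 2 ξ) = ∑ i, x i * ξ i := by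
        simp [PiLp.inner_apply, mul_comm]
      rw [EuclideanSpace.real_norm_sq_eq, h5] at h3
      simp only at h3
      linarith)
  have hR : 0 ≤ R := (sq_nonneg _).trans hx
  have hlk : l + k * ‖x‖ ^ 2 ≤ 4 * (m + 2) ^ 2 * c * R ^ (m + 1) := by
    have : l + k * ‖x‖ ^ 2 = (2 * (m + 2) + 4 * (m + 2) * (m + 1)) * c * (‖x‖ ^ 2) ^ (m + 1) := by
      rw [hl, hk]; ring
    rw [this]
    gcongr
    nlinarith [(Nat.cast_nonneg m : (0 : ℝ) ≤ m)]
  have hcoord : ∀ i, |x i| ≤ ‖x‖ := fun i => by simpa using PiLp.norm_apply_le x i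
  have hentry : ∀ i j, a i j * ((if i = j then l else 0) + k * (x i * x j))
      ≤ 4 * (m + 2) ^ 2 * c * R ^ (m + 1) * |a i j| := by
    intro i j
    refine (le_abs_self _).trans ?_
    rw [abs_mul, mul_comm]
    refine mul_le_mul_of_nonneg_right ?_ (abs_nonneg _)
    refine le_trans ?_ hlk
    refine (abs_add_le _ _).trans (add_le_add ?_ ?_)
    · split_ifs <;> simp [abs_of_nonneg hl0, hl0]
    · rw [abs_mul, abs_of_nonneg hk0, abs_mul, pow_two]
      gcongr
      exacts [hcoord i, hcoord j]
  simp_rw [mul_sub, Finset.sum_sub_distrib] at htr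
  refine (sub_nonneg.1 htr).trans ?_
  simp_rw [Finset.mul_sum]
  exact Finset.sum_le_sum fun i _ => Finset.sum_le_sum fun j _ => hentry i j

set_option maxHeartbeats 400000 in
/-- Comparison with a polynomial barrier: if `M₁`, `M₂` are the suprema of a subsolution over
the inner and outer cylinders, there is a point in the outer ball, and a value of the solution
close to `M₁`, at which `p g` or `p h` is controlled by the size of the barrier. -/
theorem exists_point_bound_of_subsolution {n : ℕ}
    {a : Eucl n → ℝ → Fin n → Fin n → ℝ} {f : Eucl n → ℝ → Eucl n → ℝ}
    {g h : ℝ → ℝ} {p : Eucl n → ℝ} {u : Eucl n → ℝ → ℝ} {du : Eucl n → ℝ → Eucl n}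
    {d2u : Eucl n → ℝ → Fin n → Fin n → ℝ} {ut : Eucl n → ℝ → ℝ}
    (ha : ∀ (x : Eucl n) (ζ : ℝ), ζ ≠ 0 → ∀ ξ : Eucl n, ξ ≠ 0 →
      0 < ∑ i, ∑ j, a x ζ i j * ξ i * ξ j)
    (hf : ∀ (x : Eucl n) (ζ : ℝ), ζ ≠ 0 → ∀ lam : ℝ, 0 ≤ lam → lam ≤ p x * h |ζ| →
      p x * g |ζ| * (1 + ∑ i, ∑ j, |a x ζ i j|) ≤ f x ζ (lam • x) * Real.sign ζ)
    (hdu : ∀ (x : Eucl n) (t : ℝ), 0 < t → ∀ i,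
      HasDerivAt (fun s : ℝ => u (x + s • EuclideanSpace.single i (1 : ℝ)) t) (du x t i) 0)
    (hd2u : ∀ (x : Eucl n) (t : ℝ), 0 < t → ∀ i j,
      HasDerivAt (fun s : ℝ => du (x + s • EuclideanSpace.single j (1 : ℝ)) t i)
        (d2u x t i j) 0)
    (hut : ∀ (x : Eucl n) (t : ℝ), 0 < t → HasDerivAt (fun τ : ℝ => u x τ) (ut x t) t)
    (huc : ContinuousOn (fun q : Eucl n × ℝ => u q.1 q.2) (univ ×ˢ Ioi 0))
    (hduc : ∀ i, ContinuousOn (fun q : Eucl n × ℝ => du q.1 q.2 i) (univ ×ˢ Ioi 0))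
    (hd2uc : ∀ i j, ContinuousOn (fun q : Eucl n × ℝ => d2u q.1 q.2 i j) (univ ×ˢ Ioi 0))
    (hsol : ∀ (x : Eucl n) (t : ℝ), 0 < t →
      ut x t - (∑ i, ∑ j, a x (u x t) i j * d2u x t i j) + f x (u x t) (du x t) ≤ 0)
    {r t M₁ M₂ μ δ : ℝ} (m : ℕ) (hr : 0 < r) (ht : 4 * r ^ 2 < t)
    (hM₁ : M₁ = sSup ((fun q : Eucl n × ℝ => u q.1 q.2) ''
      (ball (0 : Eucl n) r ×ˢ Ioo (t - r ^ 2) t)))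
    (hM₂ : M₂ = sSup ((fun q : Eucl n × ℝ => u q.1 q.2) ''
      (ball (0 : Eucl n) (2 * r) ×ˢ Ioo (t - 4 * r ^ 2) t)))
    (hμ : 0 < μ) (hδ : 2 / 4 ^ (m + 2) ≤ δ) (hgap : M₂ - M₁ < μ * (1 - δ))
    (hpos : 0 < M₁ - δ * μ) :
    ∃ x ∈ ball (0 : Eucl n) (2 * r), ∃ v, M₁ - δ * μ ≤ v ∧ v ≤ M₂ ∧
      (p x * g v ≤ (m + 2) ^ 2 * μ / r ^ 2 ∨ p x * h v ≤ (m + 2) ^ 2 * μ / r ^ 2) := by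
  have hm : (0 : ℝ) ≤ m := Nat.cast_nonneg m
  have hm1 : (m : ℝ) + 2 ≤ 4 * (m + 2) ^ 2 := by nlinarith
  have hm2 : 2 * ((m : ℝ) + 2) ≤ 4 * (m + 2) ^ 2 := by nlinarith
  have hr2 : 0 < r ^ 2 := by positivity
  set R := 4 * r ^ 2 with hRdef
  have hR : 0 < R := by positivity
  set c := μ / R ^ (m + 2) with hcdef
  have hc : 0 < c := by positivity
  have hcR : c * R ^ (m + 2) = μ := by rw [hcdef]; field_simp
  have hcR' : 4 * c * R ^ (m + 1) = μ / r ^ 2 := by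
    rw [eq_div_iff (by positivity), ← hcR, hRdef]; ring
  have hcr : c * (r ^ 2) ^ (m + 2) * 2 ≤ δ * μ := by
    have h4 : c * (r ^ 2) ^ (m + 2) * 2 = 2 / 4 ^ (m + 2) * μ := by
      rw [← hcR, hRdef, mul_pow]; field_simp
    rw [h4]
    gcongr
  set U : Eucl n × ℝ → ℝ := fun q => u q.1 q.2 with hU
  set W : Eucl n × ℝ → ℝ := fun q =>
    U q - c * (‖q.1‖ ^ 2) ^ (m + 2) - c * (t - q.2) ^ (m + 2) with hW
  set K : Set (Eucl n × ℝ) := closedBall 0 (2 * r) ×ˢ Icc (t - R) t with hK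
  have hKc : IsCompact K := (isCompact_closedBall _ _).prod isCompact_Icc
  have hKsub : K ⊆ univ ×ˢ Ioi 0 := by
    rintro ⟨x, s⟩ ⟨_, hs⟩
    exact ⟨trivial, by have := hs.1; simp only [mem_Ioi]; linarith⟩
  have hUc : ContinuousOn U K := huc.mono hKsub
  have hsub : ball (0 : Eucl n) (2 * r) ×ˢ Ioo (t - R) t ⊆ K :=
    prod_mono ball_subset_closedBall Ioo_subset_Icc_self
  have hclos : closure (ball (0 : Eucl n) (2 * r) ×ˢ Ioo (t - R) t) = K := by
    rw [closure_prod_eq, closure_ball _ (by positivity), closure_Ioo (by linarith)]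
  have hleM₂ : ∀ q ∈ K, U q ≤ M₂ := by
    have hb : BddAbove (U '' (ball (0 : Eucl n) (2 * r) ×ˢ Ioo (t - R) t)) :=
      (hKc.bddAbove_image hUc).mono (image_mono hsub)
    intro q hq
    rw [← hclos] at hq hUc
    exact le_on_closure (f := U) (g := fun _ => M₂)
      (fun y hy => hM₂ ▸ le_csSup hb (mem_image_of_mem _ hy)) hUc continuousOn_const hq
  have hWc : ContinuousOn W K := by
    refine (hUc.sub (Continuous.continuousOn ?_)).sub (Continuous.continuousOn ?_) <;> fun_prop
  have hKne : K.Nonempty := ⟨(0, t), by simp [hK, hr.le, hR.le]⟩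
  obtain ⟨⟨x, s⟩, hxs, hmax⟩ := hKc.exists_isMaxOn hKne hWc
  have hWmax : M₁ - δ * μ ≤ W (x, s) := by
    rw [sub_le_iff_le_add, hM₁]
    refine csSup_le ?_ ?_
    · refine Set.Nonempty.image _ ⟨(0, t - r ^ 2 / 2), ?_, ?_, ?_⟩
      · simpa using hr
      · simp only; linarith
      · simp only; linarith
    · rintro _ ⟨⟨y, τ⟩, ⟨hy, hτ⟩, rfl⟩
      simp only [mem_ball_zero_iff] at hy
      simp only [mem_Ioo] at hτ
      have hyK : (y, τ) ∈ K := by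
        refine ⟨by simp only [mem_closedBall_zero_iff]; linarith, ?_, hτ.2.le⟩
        simp only
        linarith
      have h1 : W (y, τ) ≤ W (x, s) := hmax hyK
      have h2 : c * (‖y‖ ^ 2) ^ (m + 2) ≤ c * (r ^ 2) ^ (m + 2) := by gcongr
      have h3 : c * (t - τ) ^ (m + 2) ≤ c * (r ^ 2) ^ (m + 2) := by
        have : 0 ≤ t - τ := by linarith
        gcongr
        linarith
      have h4 : W (y, τ) = U (y, τ) - c * (‖y‖ ^ 2) ^ (m + 2) - c * (t - τ) ^ (m + 2) := rfl
      linarith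
  have hxK : ‖x‖ ≤ 2 * r := by simpa using hxs.1
  have hsK : t - R ≤ s ∧ s ≤ t := hxs.2
  have hWeq : W (x, s) = u x s - c * (‖x‖ ^ 2) ^ (m + 2) - c * (t - s) ^ (m + 2) := rfl
  have hn1 : 0 ≤ c * (‖x‖ ^ 2) ^ (m + 2) := by positivity
  have hn2 : 0 ≤ c * (t - s) ^ (m + 2) := by
    have : 0 ≤ t - s := by linarith
    positivity
  have hvM₂ : u x s ≤ M₂ := hleM₂ _ hxs
  have hx : ‖x‖ < 2 * r := by
    refine lt_of_le_of_ne hxK fun he => ?_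
    have : c * (‖x‖ ^ 2) ^ (m + 2) = μ := by rw [← hcR, he, hRdef]; ring
    linarith
  have hs : t - R < s := by
    refine lt_of_le_of_ne hsK.1 fun he => ?_
    have : c * (t - s) ^ (m + 2) = μ := by rw [← hcR, ← he]; ring
    linarith
  have hs0 : 0 < s := by linarith
  have hv : M₁ - δ * μ ≤ u x s := by linarith
  have hv0 : 0 < u x s := by linarith
  have hslice : ∀ {G : Eucl n × ℝ → ℝ}, ContinuousOn G (univ ×ˢ Ioi 0) →
      Continuous fun y => G (y, s) := fun hG =>
    hG.comp_continuous (by fun_prop) fun y => ⟨trivial, hs0⟩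
  have hlocmax : IsLocalMax (fun y => u y s - c * (‖y‖ ^ 2) ^ (m + 2)) x := by
    filter_upwards [isOpen_ball.mem_nhds (mem_ball_zero_iff.2 hx)] with y hy
    have : W (y, s) ≤ W (x, s) := hmax ⟨ball_subset_closedBall hy, hxs.2⟩
    simp only [hW] at this
    linarith
  have hxR : ‖x‖ ^ 2 ≤ R := by 
    calc ‖x‖ ^ 2 ≤ (2 * r) ^ 2 := by gcongr
      _ = R := by rw [hRdef]; ring
  obtain ⟨hgrad, htrace⟩ := derivs_of_isLocalMax_sub_norm_pow (D := fun i y => du y s i)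
    (H := fun i j y => d2u y s i j) (fun y i => hdu y s hs0 i) (fun y i j => hd2u y s hs0 i j)
    (fun i => hslice (hduc i)) (fun i j => hslice (hd2uc i j)) (ha x (u x s) hv0.ne') hc.le m
    hxR hlocmax
  have htime : -((m + 2) * c * R ^ (m + 1)) ≤ ut x s := by
    have hder : HasDerivAt (fun τ => u x τ - c * (t - τ) ^ (m + 2))
        (ut x s + (m + 2) * c * (t - s) ^ (m + 1)) s := by
      refine ((hut x s hs0).sub ((((hasDerivAt_id s).const_sub t).pow (m + 2)).const_mul
        c)).congr_deriv ?_
      simp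
      ring
    have hle : IsLocalMaxOn (fun τ => u x τ - c * (t - τ) ^ (m + 2)) (Icc (t - R) s) s := by
      refine IsMaxOn.localize fun τ hτ => ?_
      have : W (x, τ) ≤ W (x, s) := hmax ⟨hxs.1, hτ.1, hτ.2.trans hsK.2⟩
      simp only [hW] at this
      change u x τ - _ ≤ u x s - _
      linarith
    have h1 := hle.hasFDerivWithinAt_nonpos hder.hasFDerivAt.hasFDerivWithinAt
      (sub_mem_posTangentConeAt_of_segment_subset (y := t - R) (by
        rw [segment_symm, segment_eq_Icc hs.le]))
    simp at h1
    have h2 : 0 ≤ ut x s + (m + 2) * c * (t - s) ^ (m + 1) := by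
      by_contra! hneg
      linarith [mul_pos_of_neg_of_neg (by linarith : t - R - s < 0) hneg]
    have h3 : (m + 2) * c * (t - s) ^ (m + 1) ≤ (m + 2) * c * R ^ (m + 1) := by
      have : 0 ≤ t - s := by linarith
      gcongr
      linarith
    linarith
  set l := 2 * (m + 2) * c * (‖x‖ ^ 2) ^ (m + 1) with hl
  have hl0 : 0 ≤ l := by positivity
  have hB0 : 0 < c * R ^ (m + 1) := by positivity
  have hBdef : (m + 2) ^ 2 * μ / r ^ 2 = 4 * (m + 2) ^ 2 * c * R ^ (m + 1) := by
    rw [mul_div_assoc, ← hcR']; ring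
  have hdux : du x s = l • x := by
    ext i
    simpa using hgrad i
  refine ⟨x, mem_ball_zero_iff.2 hx, u x s, hv, hvM₂, ?_⟩
  rw [hBdef]
  by_cases hlp : l ≤ p x * h (u x s)
  · left
    have h1 := hf x (u x s) hv0.ne' l hl0 (by rwa [abs_of_pos hv0])
    rw [abs_of_pos hv0, Real.sign_of_pos hv0, mul_one, ← hdux] at h1
    have h2 := hsol x s hs0
    have hA : 0 ≤ ∑ i, ∑ j, |a x (u x s) i j| :=
      Finset.sum_nonneg fun i _ => Finset.sum_nonneg fun j _ => abs_nonneg _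
    have h3 : (m + 2) * c * R ^ (m + 1) ≤ 4 * (m + 2) ^ 2 * c * R ^ (m + 1) := by
      gcongr
    refine le_of_mul_le_mul_right ?_ (by linarith : 0 < 1 + ∑ i, ∑ j, |a x (u x s) i j|)
    linarith
  · right
    refine (not_le.1 hlp).le.trans ?_
    rw [hl]
    gcongr

/-- The infimum of a positive function over the interval `(ζ / σ, σ ζ)` is measurable in `ζ`. -/
theorem measurable_sInf_image_Ioo {g : ℝ → ℝ} {σ : ℝ} (hσ : 1 < σ) (hg : ∀ s, 0 < s → 0 < g s) :
    Measurable fun ζ : ℝ => sInf (g '' Ioo (ζ / σ) (σ * ζ)) := by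
  have hσ0 : 0 < σ := by linarith
  refine measurable_of_Iio fun c => ?_
  have hsplit : (fun ζ : ℝ => sInf (g '' Ioo (ζ / σ) (σ * ζ))) ⁻¹' Iio c =
      (⋃ s ∈ {s | g s < c}, Ioi 0 ∩ {ζ : ℝ | ζ / σ < s} ∩ {ζ : ℝ | s < σ * ζ}) ∪
        (Iic 0 ∩ {_ζ : ℝ | 0 < c}) := by
    ext ζ
    simp only [mem_preimage, mem_Iio, mem_union, mem_iUnion, mem_inter_iff, mem_Ioi, mem_Iic]
    rcases le_or_gt ζ 0 with hζ | hζ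
    · have hempty : Ioo (ζ / σ) (σ * ζ) = ∅ := by
        refine Ioo_eq_empty_of_le ?_
        rw [le_div_iff₀ hσ0]
        nlinarith [mul_nonneg (neg_nonneg.2 hζ) (by nlinarith : 0 ≤ σ * σ - 1)]
      rw [hempty]
      simp [hζ, hζ.not_gt]
    · have hlt : ζ / σ < σ * ζ := by
        rw [div_lt_iff₀ hσ0]
        nlinarith [mul_pos hσ0 hζ]
      rw [csInf_lt_iff ⟨0, ?_⟩ ((nonempty_Ioo.2 hlt).image g)]
      · simp only [exists_mem_image, mem_Ioo, hζ, hζ.not_ge, true_and, false_and, or_false]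
        exact exists_congr fun s => by
          simp only [exists_prop]
          exact and_comm
      · rintro _ ⟨s, hs, rfl⟩
        exact (hg s ((div_pos hζ hσ0).trans hs.1)).le
  rw [hsplit]
  refine MeasurableSet.union (IsOpen.measurableSet ?_) (measurableSet_Iic.inter (.const _))
  exact isOpen_biUnion fun s _ => (isOpen_Ioi.inter
    (isOpen_lt (by fun_prop) continuous_const)).inter (isOpen_lt continuous_const (by fun_prop))

/-- A lower bound for `∫ dζ / g_σ(ζ)` in terms of the value of `g` at one point. -/
theorem sub_mul_inv_le_integral_inv_sInf {g : ℝ → ℝ} {σ A b B v : ℝ} (hσ : 1 < σ)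
    (hg : ∀ s, 0 < s → 0 < g s)
    (hinf : ∀ K : Set ℝ, IsCompact K → K ⊆ Ioi 0 → K.Nonempty → 0 < sInf (g '' K))
    (hA : 0 < A) (hAb : A ≤ b) (hbB : b ≤ B)
    (hv : ∀ ζ ∈ Ioo A b, v ∈ Ioo (ζ / σ) (σ * ζ)) :
    (b - A) * (g v)⁻¹ ≤ ∫ ζ in A..B, (sInf (g '' Ioo (ζ / σ) (σ * ζ)))⁻¹ := by
  have hσ0 : 0 < σ := by linarith
  set G : ℝ → ℝ := fun ζ => sInf (g '' Ioo (ζ / σ) (σ * ζ)) with hG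
  set K := Icc (A / σ) (σ * B) with hK
  have hKpos : K ⊆ Ioi 0 := fun s hs => (div_pos hA hσ0).trans_le hs.1
  have hlt : ∀ ζ, 0 < ζ → ζ / σ < σ * ζ := fun ζ hζ => by
    rw [div_lt_iff₀ hσ0]
    nlinarith [mul_pos hσ0 hζ]
  have hKne : K.Nonempty := by
    refine nonempty_Icc.2 ((hlt A hA).le.trans ?_)
    gcongr
    exact hAb.trans hbB
  have hc0 := hinf K isCompact_Icc hKpos hKne
  have hGle : ∀ ζ ∈ Icc A B, sInf (g '' K) ≤ G ζ := fun ζ hζ => by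
    refine csInf_le_csInf ⟨0, ?_⟩ ((nonempty_Ioo.2 (hlt ζ (hA.trans_le hζ.1))).image g)
      (image_mono fun s hs => ⟨le_trans ?_ hs.1.le, hs.2.le.trans ?_⟩)
    · rintro _ ⟨s, hs, rfl⟩
      exact (hg s (hKpos hs)).le
    · have := hζ.1; gcongr
    · have := hζ.2; gcongr
  have hint : ∀ {c d : ℝ}, A ≤ c → c ≤ d → d ≤ B →
      IntervalIntegrable (fun ζ => (G ζ)⁻¹) volume c d := by
    intro c d hc hcd hd
    rw [intervalIntegrable_iff_integrableOn_Ioc_of_le hcd]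
    refine Measure.integrableOn_of_bounded (M := (sInf (g '' K))⁻¹) measure_Ioc_lt_top.ne
      (measurable_sInf_image_Ioo hσ hg).inv.aestronglyMeasurable ?_
    refine (ae_restrict_iff' measurableSet_Ioc).2 (Eventually.of_forall fun ζ hζ => ?_)
    have h1 := hGle ζ ⟨hc.trans hζ.1.le, hζ.2.trans hd⟩
    rw [Real.norm_eq_abs, abs_of_pos (inv_pos.2 (hc0.trans_le h1))]
    gcongr
  rw [← intervalIntegral.integral_add_adjacent_intervals (hint le_rfl hAb hbB)
    (hint hAb hbB le_rfl)]
  have h1 : 0 ≤ ∫ ζ in b..B, (G ζ)⁻¹ := intervalIntegral.integral_nonneg hbB fun ζ hζ =>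
    (inv_pos.2 (hc0.trans_le (hGle ζ ⟨hAb.trans hζ.1, hζ.2⟩))).le
  have h2 : ∫ _ζ in A..b, (g v)⁻¹ ≤ ∫ ζ in A..b, (G ζ)⁻¹ := by
    refine intervalIntegral.integral_mono_on_of_le_Ioo hAb intervalIntegrable_const
      (hint le_rfl hAb hbB) fun ζ hζ => ?_
    have hζ0 : 0 < ζ := hA.trans hζ.1
    have h3 := hGle ζ ⟨hζ.1.le, hζ.2.le.trans hbB⟩
    refine inv_anti₀ (hc0.trans_le h3) (csInf_le ⟨0, ?_⟩ (mem_image_of_mem g (hv ζ hζ)))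
    rintro _ ⟨s, hs, rfl⟩
    exact (hg s ((div_pos hζ0 hσ0).trans hs.1)).le
  rw [intervalIntegral.integral_const, smul_eq_mul] at h2
  linarith

/-- An upper bound for `∫ ρ q(2ρ) dρ` over `(r, 2r)`. -/
theorem integral_mul_sInf_ball_le {n : ℕ} {p : Eucl n → ℝ} (hp : ∀ x, 0 ≤ p x) {r : ℝ}
    (hr : 0 < r) :
    ∫ ρ in r..(2 * r), ρ * sInf (p '' ball (0 : Eucl n) (2 * ρ)) ≤
      2 * r ^ 2 * sInf (p '' ball (0 : Eucl n) (2 * r)) := by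
  have hq : ∀ ρ, 0 ≤ sInf (p '' ball (0 : Eucl n) ρ) := fun ρ =>
    Real.sInf_nonneg (by rintro _ ⟨x, _, rfl⟩; exact hp x)
  have h := intervalIntegral.norm_integral_le_of_norm_le_const (a := r) (b := 2 * r)
    (f := fun ρ => ρ * sInf (p '' ball (0 : Eucl n) (2 * ρ)))
    (C := 2 * r * sInf (p '' ball (0 : Eucl n) (2 * r))) fun ρ hρ => by
      rw [uIoc_of_le (by linarith)] at hρ
      have hρ0 : 0 < ρ := hr.trans hρ.1
      rw [Real.norm_eq_abs, abs_of_nonneg (mul_nonneg hρ0.le (hq _))]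
      refine mul_le_mul hρ.2 ?_ (hq _) (by positivity)
      refine csInf_le_csInf ⟨0, ?_⟩ ?_ (image_mono (ball_subset_ball (by linarith [hρ.1])))
      · rintro _ ⟨x, _, rfl⟩
        exact hp x
      · exact (nonempty_ball.2 (by positivity)).image p
  refine (le_abs_self _).trans (h.trans_eq ?_)
  rw [show 2 * r - r = r by ring, abs_of_pos hr]
  ring

/-- **Lemma 3.4.** There is a constant `C > 0` depending only on `n` and `θ` such that
for any classical solution `u` of the parabolic inequality (under the structural
assumptions) and any `r > 0`, `t > 0` with `4r² < t` and
`√θ · M₁ ≥ M₂ = sup_{Q_{2r}^{t−4r²,t}} u > 0` where `M₁ = sup_{Q_r^{t−r²,t}} u`,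
at least one of the estimates (i) `∫_{M₁}^{M₂} dζ/g_{√θ}(ζ) ≥ C ∫_r^{2r} ρ q(2ρ) dρ` or
(ii) `∫_{M₁}^{M₂} dζ/h_{√θ}(ζ) ≥ C ∫_r^{2r} ρ q(2ρ) dρ` holds. -/
theorem lemma_3_4
    (n : ℕ) (hn : 1 ≤ n) (θ : ℝ) (hθ : 1 < θ) :
    ∃ C : ℝ, 0 < C ∧
      ∀ (a : Eucl n → ℝ → Fin n → Fin n → ℝ)
        (f : Eucl n → ℝ → Eucl n → ℝ)
        (g h : ℝ → ℝ) (p : Eucl n → ℝ)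
        (u : Eucl n → ℝ → ℝ) (du : Eucl n → ℝ → Eucl n)
        (d2u : Eucl n → ℝ → Fin n → Fin n → ℝ) (ut : Eucl n → ℝ → ℝ),
        -- ellipticity
        (∀ (x : Eucl n) (ζ : ℝ), ζ ≠ 0 → ∀ ξ : Eucl n, ξ ≠ 0 →
          0 < ∑ i, ∑ j, a x ζ i j * ξ i * ξ j) →
        -- g, h : (0,∞) → (0,∞) measurable, locally bounded, positive inf on compacts
        Measurable g → Measurable h →
        (∀ s : ℝ, 0 < s → 0 < g s) → (∀ s : ℝ, 0 < s → 0 < h s) →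
        (∀ K : Set ℝ, IsCompact K → K ⊆ Ioi 0 → BddAbove (g '' K)) →
        (∀ K : Set ℝ, IsCompact K → K ⊆ Ioi 0 → BddAbove (h '' K)) →
        (∀ K : Set ℝ, IsCompact K → K ⊆ Ioi 0 → K.Nonempty → 0 < sInf (g '' K)) →
        (∀ K : Set ℝ, IsCompact K → K ⊆ Ioi 0 → K.Nonempty → 0 < sInf (h '' K)) →
        -- p : ℝⁿ → [0,∞) measurable and locally bounded
        Measurable p → (∀ x, 0 ≤ p x) →
        (∀ K : Set (Eucl n), IsCompact K → BddAbove (p '' K)) →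
        -- the structural condition (1.2)
        (∀ (x : Eucl n) (ζ : ℝ), ζ ≠ 0 → ∀ lam : ℝ, 0 ≤ lam → lam ≤ p x * h |ζ| →
          p x * g |ζ| * (1 + ∑ i, ∑ j, |a x ζ i j|) ≤ f x ζ (lam • x) * Real.sign ζ) →
        -- `u` is a classical solution of the differential inequality
        (∀ (x : Eucl n) (t : ℝ), 0 < t → ∀ i,
          HasDerivAt (fun s : ℝ => u (x + s • EuclideanSpace.single i (1 : ℝ)) t)
            (du x t i) 0) →
        (∀ (x : Eucl n) (t : ℝ), 0 < t → ∀ i j,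
          HasDerivAt (fun s : ℝ => du (x + s • EuclideanSpace.single j (1 : ℝ)) t i)
            (d2u x t i j) 0) →
        (∀ (x : Eucl n) (t : ℝ), 0 < t → HasDerivAt (fun τ : ℝ => u x τ) (ut x t) t) →
        ContinuousOn (fun q : Eucl n × ℝ => u q.1 q.2) (univ ×ˢ Ioi 0) →
        (∀ i, ContinuousOn (fun q : Eucl n × ℝ => du q.1 q.2 i) (univ ×ˢ Ioi 0)) →
        (∀ i j, ContinuousOn (fun q : Eucl n × ℝ => d2u q.1 q.2 i j) (univ ×ˢ Ioi 0)) →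
        ContinuousOn (fun q : Eucl n × ℝ => ut q.1 q.2) (univ ×ˢ Ioi 0) →
        (∀ (x : Eucl n) (t : ℝ), 0 < t →
          ut x t - (∑ i, ∑ j, a x (u x t) i j * d2u x t i j) + f x (u x t) (du x t) ≤ 0) →
        -- the radii, times and suprema
        ∀ r t M₁ M₂ : ℝ,
          0 < r → 4 * r ^ 2 < t →
          M₁ = sSup ((fun q : Eucl n × ℝ => u q.1 q.2) ''
            (ball (0 : Eucl n) r ×ˢ Ioo (t - r ^ 2) t)) →
          M₂ = sSup ((fun q : Eucl n × ℝ => u q.1 q.2) ''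
            (ball (0 : Eucl n) (2 * r) ×ˢ Ioo (t - 4 * r ^ 2) t)) →
          0 < M₂ → M₂ ≤ Real.sqrt θ * M₁ →
          (C * ∫ ρ in r..(2 * r), ρ * sInf (p '' ball (0 : Eucl n) (2 * ρ))
              ≤ ∫ ζ in M₁..M₂,
                  (sInf (g '' Ioo (ζ / Real.sqrt θ) (Real.sqrt θ * ζ)))⁻¹ ∨
           C * ∫ ρ in r..(2 * r), ρ * sInf (p '' ball (0 : Eucl n) (2 * ρ))
              ≤ ∫ ζ in M₁..M₂,
                  (sInf (h '' Ioo (ζ / Real.sqrt θ) (Real.sqrt θ * ζ)))⁻¹) := by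
  have hσ : 1 < Real.sqrt θ := Real.lt_sqrt_of_sq_lt (by simpa using hθ)
  set σ := Real.sqrt θ
  obtain ⟨m, hm⟩ := pow_unbounded_of_one_lt (16 * σ) (by norm_num : (1 : ℝ) < 4)
  have hδ : 2 / 4 ^ (m + 2) ≤ 1 / (8 * σ) := by
    rw [div_le_div_iff₀ (by positivity) (by positivity)]
    have : (4 : ℝ) ^ m ≤ 4 ^ (m + 2) := pow_le_pow_right₀ (by norm_num) (by omega)
    linarith
  set δ := 1 / (8 * σ) with hδdef
  have hδσ : σ * δ = 1 / 8 := by rw [hδdef]; field_simp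
  have hδ0 : 0 < δ := by positivity
  have hδ1 : δ < 1 / 8 := by nlinarith
  set κ : ℝ := (m + 2) ^ 2
  have hκ : 0 < κ := by positivity
  refine ⟨1 / (8 * κ), by positivity, ?_⟩
  intro a f g h p u du d2u ut ha _ _ hg hh _ _ hginf hhinf _ hp _ hf hdu hd2u hut huc hduc hd2uc
    _ hsol r t M₁ M₂ hr ht hM₁ hM₂ hM₂pos hM₂le
  have hM₁pos : 0 < M₁ := by nlinarith
  have hpoint := fun μ => exists_point_bound_of_subsolution (μ := μ) ha hf hdu hd2u hut huc hduc
    hd2uc hsol m hr ht hM₁ hM₂ (hδ := hδ)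
  have hle : M₁ ≤ M₂ := by
    by_contra! hlt
    obtain ⟨_, _, v, hv, hv', _⟩ := hpoint (M₁ - M₂) (by linarith) (by nlinarith) (by nlinarith)
    nlinarith
  have hI := integral_mul_sInf_ball_le hp hr
  set I := ∫ ρ in r..(2 * r), ρ * sInf (p '' ball (0 : Eucl n) (2 * ρ))
  set Q := sInf (p '' ball (0 : Eucl n) (2 * r)) with hQ
  have hQle : ∀ x ∈ ball (0 : Eucl n) (2 * r), Q ≤ p x := fun x hx =>
    csInf_le ⟨0, by rintro _ ⟨x, _, rfl⟩; exact hp x⟩ (mem_image_of_mem p hx)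
  rcases hle.lt_or_eq with hlt | heq
  · obtain ⟨x, hx, v, hv, hv', hpv⟩ := hpoint (2 * (M₂ - M₁)) (by linarith) (by nlinarith)
      (by nlinarith)
    have hv0 : 0 < v := by nlinarith
    have hvσ : (M₁ + M₂) / 2 ≤ σ * v := by nlinarith
    have hvmem : ∀ ζ ∈ Ioo M₁ ((M₁ + M₂) / 2), v ∈ Ioo (ζ / σ) (σ * ζ) := fun ζ hζ => by
      refine ⟨?_, ?_⟩
      · rw [div_lt_iff₀ (by linarith)]
        linarith [hζ.2]
      · nlinarith [hζ.1]
    have hbound : ∀ G : ℝ → ℝ, 0 < G v → p x * G v ≤ κ * (2 * (M₂ - M₁)) / r ^ 2 →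
        1 / (8 * κ) * I ≤ ((M₁ + M₂) / 2 - M₁) * (G v)⁻¹ := by
      intro G hG hle'
      rw [le_div_iff₀ (by positivity)] at hle'
      rw [← div_eq_mul_inv, le_div_iff₀ hG, div_mul_eq_mul_div, div_mul_eq_mul_div, one_mul,
        div_le_iff₀ (by positivity)]
      have h1 : I ≤ 2 * r ^ 2 * p x := hI.trans (by gcongr; exact hQle x hx)
      calc I * G v ≤ 2 * r ^ 2 * p x * G v := by gcongr
        _ ≤ _ := by linarith
    rcases hpv with hpv | hpv
    · exact Or.inl ((hbound g (hg v hv0) hpv).trans (sub_mul_inv_le_integral_inv_sInf hσ hg hginf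
        hM₁pos (by linarith) (by linarith) hvmem))
    · exact Or.inr ((hbound h (hh v hv0) hpv).trans (sub_mul_inv_le_integral_inv_sInf hσ hh hhinf
        hM₁pos (by linarith) (by linarith) hvmem))
  · have hQ0 : Q ≤ 0 := by
      by_contra! hQpos
      have hKpos : Icc (M₁ / 2) M₁ ⊆ Ioi 0 := fun s hs => (half_pos hM₁pos).trans_le hs.1
      have hKne : (Icc (M₁ / 2) M₁).Nonempty := nonempty_Icc.2 (by linarith)
      have hcg := hginf _ isCompact_Icc hKpos hKne
      have hch := hhinf _ isCompact_Icc hKpos hKne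
      set c := min (sInf (g '' Icc (M₁ / 2) M₁)) (sInf (h '' Icc (M₁ / 2) M₁))
      have hc : 0 < c := lt_min hcg hch
      set μ := min M₁ (Q * c * r ^ 2 / (2 * κ))
      have hμ : 0 < μ := lt_min hM₁pos (by positivity)
      have hμM : μ ≤ M₁ := min_le_left _ _
      obtain ⟨x, hx, v, hv, hv', hpv⟩ := hpoint μ hμ (by nlinarith) (by nlinarith)
      have hvK : v ∈ Icc (M₁ / 2) M₁ := ⟨by nlinarith, by linarith⟩
      have hlow : ∀ G : ℝ → ℝ, (∀ s, 0 < s → 0 < G s) → c ≤ sInf (G '' Icc (M₁ / 2) M₁) →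
          κ * μ / r ^ 2 < p x * G v := by
        intro G hG hcG
        have h1 : c ≤ G v := hcG.trans (csInf_le
          ⟨0, by rintro _ ⟨s, hs, rfl⟩; exact (hG s (hKpos hs)).le⟩ (mem_image_of_mem G hvK))
        have h2 : μ ≤ Q * c * r ^ 2 / (2 * κ) := min_le_right _ _
        rw [le_div_iff₀ (by positivity)] at h2
        have h3 : Q * c ≤ p x * G v := mul_le_mul (hQle x hx) h1 hc.le (hp x)
        refine lt_of_lt_of_le ?_ h3
        rw [div_lt_iff₀ (by positivity)]
        have : 0 < μ * κ := by positivity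
        linarith
      rcases hpv with hpv | hpv
      · exact (hlow g hg (min_le_left _ _)).not_ge hpv
      · exact (hlow h hh (min_le_right _ _)).not_ge hpv
    left
    rw [heq, intervalIntegral.integral_same]
    have hI0 : I ≤ 0 := hI.trans (mul_nonpos_of_nonneg_of_nonpos (by positivity) hQ0)
    exact mul_nonpos_of_nonneg_of_nonpos (by positivity) hI0
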